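/- arXiv:1309.4799 — 4 statements merged into one kernel-verified Lean document; each statement's English description precedes it below -/
import Mathlib

section
/- Let n ≥ 3 be an integer, let θ = 2π/n, and let j be an integer with 1 ≤ j and 2j < n. Set h = sin(jθ) (the height of the j-th horizontal cylinder of the double regular n-gon surface with unit edges) and W = 2·(1 + 2·(∑_{l=1}^{j−1} cos(lθ)) + cos(jθ)) (its width). Then h > 0 and W = 2·(cos(π/n)/sin(π/n))·h; consequently the modulus W/h equals 2·cot(π/n). -/
/-- The trapezoidal form of the Dirichlet kernel identity, at the angle `2 * a`. -/
theorem trapezoidal_cos_sum_mul_sin (a : ℝ) (k : ℕ) :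
    (1 + 2 * (∑ l ∈ Finset.Icc 1 k, Real.cos (l * (2 * a))) +
      Real.cos ((k + 1 : ℕ) * (2 * a))) * Real.sin a =
      Real.cos a * Real.sin ((k + 1 : ℕ) * (2 * a)) := by
  induction k with
  | zero =>
    simp only [zero_add, Nat.cast_one, one_mul, Real.cos_two_mul, Real.sin_two_mul]
    simp
    ring
  | succ k ih =>
    rw [Finset.sum_Icc_succ_top (by omega)]
    have hstep : ((k + 1 + 1 : ℕ) : ℝ) * (2 * a) = (k + 1 : ℕ) * (2 * a) + 2 * a := by
      push_cast
      ring
    rw [hstep, Real.cos_add, Real.sin_add, Real.cos_two_mul, Real.sin_two_mul]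
    linear_combination ih + 2 * Real.cos a * Real.sin ((k + 1 : ℕ) * (2 * a)) *
      (-Real.sin_sq_add_cos_sq a)

theorem double_ngon_cylinder_modulus (n : ℕ) (hn : 3 ≤ n) (θ : ℝ)
    (hθ : θ = 2 * Real.pi / n) (j : ℕ) (hj1 : 1 ≤ j) (hj2 : 2 * j < n)
    (h W : ℝ) (hh : h = Real.sin (j * θ))
    (hW : W = 2 * (1 + 2 * (∑ l ∈ Finset.Icc 1 (j - 1), Real.cos (l * θ)) + Real.cos (j * θ))) :
    0 < h ∧ W = 2 * (Real.cos (Real.pi / n) / Real.sin (Real.pi / n)) * h ∧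
      W / h = 2 * (Real.cos (Real.pi / n) / Real.sin (Real.pi / n)) := by
  have hn0 : (0 : ℝ) < n := by exact_mod_cast (by omega : 0 < n)
  have hj0 : (0 : ℝ) < j := by exact_mod_cast hj1
  have hjn : 2 * (j : ℝ) < n := by exact_mod_cast hj2
  have hpos : 0 < h := by
    rw [hh, hθ]
    apply Real.sin_pos_of_pos_of_lt_pi
    · positivity
    · rw [mul_div_assoc', div_lt_iff₀ hn0]
      nlinarith [Real.pi_pos]
  have hsin : 0 < Real.sin (Real.pi / n) := by
    apply Real.sin_pos_of_pos_of_lt_pi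
    · positivity
    · exact div_lt_self Real.pi_pos (by exact_mod_cast (by omega : 1 < n))
  have hwidth : W = 2 * (Real.cos (Real.pi / n) / Real.sin (Real.pi / n)) * h := by
    have key := trapezoidal_cos_sum_mul_sin (Real.pi / n) (j - 1)
    rw [Nat.sub_add_cancel hj1, ← mul_div_assoc, ← hθ, ← hh] at key
    rw [hW, mul_assoc, div_mul_eq_mul_div, ← key, mul_div_cancel_right₀ _ hsin.ne']
  exact ⟨hpos, hwidth, by rw [hwidth, mul_div_cancel_right₀ _ hpos.ne']⟩
end

section
/- Let A, B, C, D ∈ ℝ² be points such that the open segments from A to C and from B to D have a common point (so that A, B, C, D form a convex quadrilateral in cyclic order with diagonals [A,C] and [B,D]). Then for every point P in the closed segment [A,B] and every point Q in the closed segment [C,D], the closed segment [P,Q] has nonempty intersection with the closed segment [A,C] and nonempty intersection with the closed segment [B,D]. -/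
theorem segment_inter_diagonal_nonempty {E : Type*} [AddCommGroup E] [Module ℝ E]
    {A B C D P Q : E} (h : (openSegment ℝ A C ∩ openSegment ℝ B D).Nonempty)
    (hP : P ∈ segment ℝ A B) (hQ : Q ∈ segment ℝ C D) :
    (segment ℝ P Q ∩ segment ℝ A C).Nonempty := by
  obtain ⟨O, ⟨a, c, ha, hc, hac, hO⟩, ⟨b, d, hb, hd, hbd, hO'⟩⟩ := h
  obtain ⟨p', p, hp', hp, hpp, rfl⟩ := hP
  obtain ⟨q', q, hq', hq, hqq, rfl⟩ := hQ
  rcases hp.eq_or_lt with rfl | hp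
  · obtain rfl : p' = 1 := by linarith
    refine ⟨A, ?_, left_mem_segment ℝ A C⟩
    simpa using left_mem_segment ℝ A (q' • C + q • D)
  have hk : 0 < q * b + p * d := by positivity
  refine ⟨(q * b / (q * b + p * d)) • (p' • A + p • B) +
      (p * d / (q * b + p * d)) • (q' • C + q • D),
    ⟨_, _, by positivity, by positivity, by field_simp, rfl⟩,
    (q * b * p' + p * q * a) / (q * b + p * d), (p * d * q' + p * q * c) / (q * b + p * d),
    by positivity, by positivity, ?_, ?_⟩
  · rw [← add_div, div_eq_one_iff_eq hk.ne']
    linear_combination q * b * hpp + p * d * hqq + p * q * hac - p * q * hbd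
  · linear_combination (norm := module) (p * q / (q * b + p * d)) • (hO.trans hO'.symm)

theorem quadrilateral_nonadjacent_crossing (A B C D : ℝ × ℝ)
    (hconv : (openSegment ℝ A C ∩ openSegment ℝ B D).Nonempty) :
    ∀ P ∈ segment ℝ A B, ∀ Q ∈ segment ℝ C D,
      (segment ℝ P Q ∩ segment ℝ A C).Nonempty ∧
      (segment ℝ P Q ∩ segment ℝ B D).Nonempty := by
  intro P hP Q hQ
  refine ⟨segment_inter_diagonal_nonempty hconv hP hQ, ?_⟩
  rw [Set.inter_comm] at hconv
  rw [segment_symm] at hP hQ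
  exact segment_inter_diagonal_nonempty hconv hP hQ
end

section
/- Let A, B, C, D ∈ ℝ² be points such that the open segments from A to C and from B to D have a common point, and assume no three of the points A, B, C, D are collinear. Then for every point P in the closed segment [A,B] and every point Q in the closed segment [B,C]: (i) the closed segment [P,Q] has nonempty intersection with the diagonal [B,D] (the diagonal through the vertex B shared by the two edges); and (ii) if P ≠ A and Q ≠ C, then the closed segment [P,Q] is disjoint from the diagonal [A,C]. -/
/-- In a vector space, a segment joining two sides of the angle at `B` meets the segment from `B`
to `D`, as soon as `[B, D]` meets the open segment from `A` to `C`. -/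
lemma segment_inter_segment_nonempty_of_mem_openSegment {E : Type*} [AddCommGroup E] [Module ℝ E]
    {A B C D P Q : E} (h : (openSegment ℝ A C ∩ segment ℝ B D).Nonempty)
    (hP : P ∈ segment ℝ A B) (hQ : Q ∈ segment ℝ B C) :
    (segment ℝ P Q ∩ segment ℝ B D).Nonempty := by
  obtain ⟨X, ⟨a, c, ha, hc, hac, rfl⟩, hX⟩ := h
  obtain ⟨s, s', hs, hs', hss, rfl⟩ := hP
  obtain ⟨t', t, ht', ht, htt, rfl⟩ := hQ
  obtain rfl : s' = 1 - s := by linarith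
  obtain rfl : t' = 1 - t := by linarith
  obtain rfl : c = 1 - a := by linarith
  rcases hs.eq_or_lt with rfl | hs0
  · exact ⟨B, by simpa using left_mem_segment ℝ B _, left_mem_segment ℝ B D⟩
  have hm : 0 < a * t + s * (1 - a) := by positivity
  have hk : s * t / (a * t + s * (1 - a)) ≤ 1 := by
    rw [div_le_one hm]
    nlinarith [mul_nonneg (mul_nonneg ha.le ht) hs', mul_nonneg (mul_nonneg hc.le hs) ht']
  have hu : s * (1 - a) / (a * t + s * (1 - a)) ≤ 1 := by
    rw [div_le_one hm]
    nlinarith [mul_nonneg ha.le ht]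
  refine ⟨(1 - s * t / (a * t + s * (1 - a))) • B +
    (s * t / (a * t + s * (1 - a))) • (a • A + (1 - a) • C), ?_, ?_⟩
  · refine ⟨1 - s * (1 - a) / (a * t + s * (1 - a)), s * (1 - a) / (a * t + s * (1 - a)),
      sub_nonneg.2 hu, by positivity, by ring, ?_⟩
    match_scalars <;> field_simp <;> ring
  · exact (convex_segment B D) (left_mem_segment ℝ B D) hX (sub_nonneg.2 hk) (by positivity)
      (by ring)

/-- In a nondegenerate triangle, a segment joining a point of `[A, B]` other than `A` to a point
of `[B, C]` other than `C` misses the third side. -/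
lemma segment_inter_segment_eq_empty_of_not_collinear {E : Type*} [AddCommGroup E] [Module ℝ E]
    {A B C P Q : E} (h : ¬ Collinear ℝ ({A, B, C} : Set E))
    (hP : P ∈ segment ℝ A B) (hQ : Q ∈ segment ℝ B C) (hPA : P ≠ A) (hQC : Q ≠ C) :
    segment ℝ P Q ∩ segment ℝ A C = ∅ := by
  rw [← affineIndependent_iff_not_collinear_set, affineIndependent_iff] at h
  obtain ⟨s, s', hs, hs', hss, rfl⟩ := hP
  obtain ⟨t', t, ht', ht, htt, rfl⟩ := hQ
  have hs0 : 0 < s' := hs'.lt_of_ne <| by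
    rintro rfl
    exact hPA (by simp [show s = 1 by linarith])
  have ht0 : 0 < t' := ht'.lt_of_ne <| by
    rintro rfl
    exact hQC (by simp [show t = 1 by linarith])
  refine Set.eq_empty_of_forall_notMem ?_
  rintro _ ⟨⟨u, v, hu, hv, huv, rfl⟩, ⟨w, x, -, -, hwx, hEq⟩⟩
  have key := h Finset.univ ![u * s - w, u * s' + v * t', v * t - x]
    (by
      simp only [Fin.sum_univ_three, Matrix.cons_val]
      linear_combination u * hss + v * htt + huv - hwx)
    (by
      simp only [Fin.sum_univ_three, Matrix.cons_val]
      rw [← sub_eq_zero] at hEq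
      rw [← neg_eq_zero, ← hEq]
      module) 1 (Finset.mem_univ _)
  simp only [Matrix.cons_val] at key
  rcases hu.eq_or_lt with rfl | hu0
  · obtain rfl : v = 1 := by linarith
    linarith
  · linarith [mul_pos hu0 hs0, mul_nonneg hv ht']

theorem quadrilateral_adjacent_crossing (A B C D : ℝ × ℝ)
    (hconv : (openSegment ℝ A C ∩ openSegment ℝ B D).Nonempty)
    (hABC : ¬ Collinear ℝ ({A, B, C} : Set (ℝ × ℝ)))
    (hABD : ¬ Collinear ℝ ({A, B, D} : Set (ℝ × ℝ)))
    (hACD : ¬ Collinear ℝ ({A, C, D} : Set (ℝ × ℝ)))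
    (hBCD : ¬ Collinear ℝ ({B, C, D} : Set (ℝ × ℝ))) :
    ∀ P ∈ segment ℝ A B, ∀ Q ∈ segment ℝ B C,
      (segment ℝ P Q ∩ segment ℝ B D).Nonempty ∧
      (P ≠ A → Q ≠ C → segment ℝ P Q ∩ segment ℝ A C = ∅) := by
  intro P hP Q hQ
  exact ⟨segment_inter_segment_nonempty_of_mem_openSegment
      (hconv.mono (Set.inter_subset_inter_right _ (openSegment_subset_segment ℝ B D))) hP hQ,
    segment_inter_segment_eq_empty_of_not_collinear hABC hP hQ⟩
end

section
/- Let n ≥ 2 be an integer and let a, b be real numbers. Define v_i ∈ ℝ² for i = 0, …, 2n−1 by v_i = a·(cos(iπ/n), sin(iπ/n)) if i is even and v_i = b·(cos(iπ/n), sin(iπ/n)) if i is odd, and define vertices p_k = ∑_{i=0}^{k−1} v_i, with indices read modulo 2n. Writing p_k = (x_k, y_k), for every k ∈ {0, …, 2n−1} one has p_{(1−k) mod 2n} = (a − x_k, y_k). In particular, the set of vertices of the (a,b) semi-regular 2n-gon is invariant under the reflection (x,y) ↦ (a − x, y) across the vertical line x = a/2, and the vertices pair up at equal heights. -/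
theorem sum_exp_add_two_pi_mul_div_eq_zero {n : ℕ} (hn : 2 ≤ n) (θ : ℝ) :
    ∑ j ∈ Finset.range n,
      Complex.exp (((θ + 2 * Real.pi * j / n : ℝ) : ℂ) * Complex.I) = 0 := by
  have hζ := (Complex.isPrimitiveRoot_exp n (by omega)).geom_sum_eq_zero (by omega)
  rw [← mul_zero (Complex.exp (θ * Complex.I)), ← hζ, Finset.mul_sum]
  refine Finset.sum_congr rfl fun j _ => ?_
  rw [← Complex.exp_nat_mul, ← Complex.exp_add]
  congr 1
  push_cast
  ring

theorem sum_cos_add_two_pi_mul_div_eq_zero {n : ℕ} (hn : 2 ≤ n) (θ : ℝ) :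
    ∑ j ∈ Finset.range n, Real.cos (θ + 2 * Real.pi * j / n) = 0 := by
  simpa only [Complex.re_sum, Complex.exp_ofReal_mul_I_re, Complex.zero_re] using
    congrArg Complex.re (sum_exp_add_two_pi_mul_div_eq_zero hn θ)

theorem sum_sin_add_two_pi_mul_div_eq_zero {n : ℕ} (hn : 2 ≤ n) (θ : ℝ) :
    ∑ j ∈ Finset.range n, Real.sin (θ + 2 * Real.pi * j / n) = 0 := by
  simpa only [Complex.im_sum, Complex.exp_ofReal_mul_I_im, Complex.zero_im] using
    congrArg Complex.im (sum_exp_add_two_pi_mul_div_eq_zero hn θ)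

theorem sum_range_two_mul {M : Type*} [AddCommMonoid M] (f : ℕ → M) (n : ℕ) :
    ∑ i ∈ Finset.range (2 * n), f i =
      ∑ j ∈ Finset.range n, f (2 * j) + ∑ j ∈ Finset.range n, f (2 * j + 1) := by
  rw [← Finset.sum_add_distrib]
  induction n with
  | zero => simp
  | succ n ih =>
    rw [Nat.mul_succ, Finset.sum_range_succ, Finset.sum_range_succ, ih,
      Finset.sum_range_succ _ n, add_assoc]

theorem semiregular_polygon_symmetric (n : ℕ) (hn : 2 ≤ n) (a b : ℝ)
    (v : ℕ → ℝ × ℝ)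
    (hv : ∀ i, v i = if Even i
        then a • (Real.cos (i * Real.pi / n), Real.sin (i * Real.pi / n))
        else b • (Real.cos (i * Real.pi / n), Real.sin (i * Real.pi / n)))
    (p : ℕ → ℝ × ℝ) (hp : ∀ k, p k = ∑ i ∈ Finset.range k, v i) :
    ∀ k < 2 * n, p ((2 * n + 1 - k) % (2 * n)) = (a - (p k).1, (p k).2) := by
  have hn0 : (n : ℝ) ≠ 0 := by positivity
  have h_even (j : ℕ) : v (2 * j) =
      a • (Real.cos (0 + 2 * Real.pi * j / n), Real.sin (0 + 2 * Real.pi * j / n)) := by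
    have h : ((2 * j : ℕ) : ℝ) * Real.pi / n = 0 + 2 * Real.pi * j / n := by
      push_cast
      ring
    rw [hv, if_pos (even_two_mul j), h]
  have h_odd (j : ℕ) : v (2 * j + 1) =
      b • (Real.cos (Real.pi / n + 2 * Real.pi * j / n),
        Real.sin (Real.pi / n + 2 * Real.pi * j / n)) := by
    have h : ((2 * j + 1 : ℕ) : ℝ) * Real.pi / n = Real.pi / n + 2 * Real.pi * j / n := by
      push_cast
      ring
    rw [hv, if_neg (by simp), h]
  have h_closed : p (2 * n) = (0, 0) := by
    rw [hp, sum_range_two_mul]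
    simp only [h_even, h_odd, ← Finset.smul_sum]
    ext <;> simp only [Prod.fst_add, Prod.snd_add, Prod.smul_fst, Prod.smul_snd, Prod.fst_sum,
      Prod.snd_sum, smul_zero, add_zero,
      sum_cos_add_two_pi_mul_div_eq_zero hn, sum_sin_add_two_pi_mul_div_eq_zero hn]
  have h_succ (k : ℕ) : p (k + 1) = p k + v k := by
    rw [hp, hp, Finset.sum_range_succ]
  have h_zero : p 0 = (0, 0) := by rw [hp, Finset.sum_range_zero, Prod.mk_zero_zero]
  have h_one : p 1 = (a, 0) := by simp [hp, hv]
  have h_reflect (k : ℕ) (hk : k ≤ 2 * n) : v (2 * n - k) = ((v k).1, -(v k).2) := by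
    have h_angle : ((2 * n - k : ℕ) : ℝ) * Real.pi / n = 2 * Real.pi - k * Real.pi / n := by
      rw [Nat.cast_sub hk]
      push_cast
      field_simp
    have h_parity : Even (2 * n - k) ↔ Even k := by
      simp [Nat.even_sub hk]
    rw [hv, hv, h_angle, Real.cos_two_pi_sub, Real.sin_two_pi_sub]
    simp only [h_parity]
    split_ifs <;> simp
  have h_symm (k : ℕ) (hk : k < 2 * n) :
      p (2 * n - k) = (a - (p (k + 1)).1, (p (k + 1)).2) := by
    induction k with
    | zero => simp [h_closed, h_one]
    | succ k ih =>
      have h_step := h_succ (2 * n - (k + 1))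
      rw [show 2 * n - (k + 1) + 1 = 2 * n - k by omega, ih (by omega),
        h_reflect (k + 1) hk.le] at h_step
      rw [eq_sub_of_add_eq h_step.symm, h_succ (k + 1)]
      ext
      · simp
        ring
      · simp
  intro k hk
  rcases k with _ | _ | k
  · rw [Nat.sub_zero, Nat.add_mod_left, Nat.mod_eq_of_lt (by omega)]
    simp [h_zero, h_one]
  · simp [h_zero, h_one]
  · rw [Nat.mod_eq_of_lt (by omega),
      show 2 * n + 1 - (k + 1 + 1) = 2 * n - (k + 1) by omega]
    exact h_symm (k + 1) (by omega)
end
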